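/- arXiv:1407.2783 — 3 statements merged into one kernel-verified Lean document; each statement's English description precedes it below -/
import Mathlib

section
/- Let G₁ and G₂ be groups. Two triples (N₁, N₂, π) and (N₁′, N₂′, π′), each consisting of normal subgroups N₁ ⊴ G₁, N₂ ⊴ G₂ and a group isomorphism π : G₁/N₁ → G₂/N₂ (respectively N₁′, N₂′, π′), define isomorphic bitransitive G₁-G₂-bisets — i.e., there is a bijection between the associated bisets commuting with both actions — if and only if N₁ = N₁′, N₂ = N₂′, and there exists b ∈ G₂/N₂ such that π(a) = b·π′(a)·b⁻¹ for all a ∈ G₁/N₁. -/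
/-- Two triples `(N₁, N₂, π)` and `(N₁′, N₂′, π′)` of normal subgroups together with
isomorphisms of the quotients define isomorphic bitransitive `G₁`-`G₂`-bisets
(i.e. there is a bijection between the associated bisets commuting with both actions)
if and only if `N₁ = N₁′`, `N₂ = N₂′` and there exists `b ∈ G₂/N₂` with
`π(a) = b·π′(a)·b⁻¹` for all `a ∈ G₁/N₁`. -/
theorem triples_give_isomorphic_bisets_iff
    {G₁ G₂ : Type*} [Group G₁] [Group G₂]
    (N₁ N₁' : Subgroup G₁) (N₂ N₂' : Subgroup G₂)
    [N₁.Normal] [N₁'.Normal] [N₂.Normal] [N₂'.Normal]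
    (π : (G₁ ⧸ N₁) ≃* (G₂ ⧸ N₂)) (π' : (G₁ ⧸ N₁') ≃* (G₂ ⧸ N₂')) :
    (∃ e : (G₂ ⧸ N₂) ≃ (G₂ ⧸ N₂'),
        (∀ (g : G₁) (a : G₂ ⧸ N₂),
          e (π (QuotientGroup.mk g) * a) = π' (QuotientGroup.mk g) * e a) ∧
        (∀ (a : G₂ ⧸ N₂) (h : G₂),
          e (a * QuotientGroup.mk h) = e a * QuotientGroup.mk h)) ↔
    (∃ (h₁ : N₁ = N₁') (h₂ : N₂ = N₂') (b : G₂ ⧸ N₂), ∀ g : G₁,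
        π (QuotientGroup.mk g)
          = b * (QuotientGroup.quotientMulEquivOfEq h₂.symm)
              (π' ((QuotientGroup.quotientMulEquivOfEq h₁) (QuotientGroup.mk g))) * b⁻¹) := by
  constructor
  · rintro ⟨e, hl, hr⟩
    have h₁ : N₁ = N₁' := by
      ext g
      rw [← QuotientGroup.eq_one_iff, ← QuotientGroup.eq_one_iff (N := N₁')]
      have h := hl g 1
      rw [mul_one] at h
      constructor
      · intro hg
        rw [hg, map_one] at h
        exact (MulEquiv.map_eq_one_iff π').1 (right_eq_mul.1 h)
      · intro hg
        rw [hg, map_one, one_mul] at h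
        exact (MulEquiv.map_eq_one_iff π).1 (e.injective h)
    have h₂ : N₂ = N₂' := by
      ext g
      rw [← QuotientGroup.eq_one_iff, ← QuotientGroup.eq_one_iff (N := N₂')]
      have h := hr 1 g
      rw [one_mul] at h
      constructor
      · intro hg
        rw [hg] at h
        exact left_eq_mul.1 h
      · intro hg
        rw [hg, mul_one] at h
        exact e.injective h
    subst h₁ h₂
    refine ⟨rfl, rfl, (e 1)⁻¹, fun g => ?_⟩
    change π (QuotientGroup.mk g) = (e 1)⁻¹ * QuotientGroup.quotientMulEquivOfEq rfl
      (π' (QuotientGroup.mk g)) * (e 1)⁻¹⁻¹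
    have hid : ∀ x : G₂ ⧸ N₂, QuotientGroup.quotientMulEquivOfEq rfl x = x := by
      intro x
      induction x using QuotientGroup.induction_on with
      | H z => rfl
    rw [hid, inv_inv, mul_assoc, ← hl g 1, mul_one, eq_inv_mul_iff_mul_eq]
    obtain ⟨h, hh⟩ := QuotientGroup.mk_surjective (π (QuotientGroup.mk g))
    rw [← hh, ← hr 1 h, one_mul]
  · rintro ⟨h₁, h₂, b, hb⟩
    subst h₁ h₂
    have hid : ∀ x : G₂ ⧸ N₂, QuotientGroup.quotientMulEquivOfEq rfl x = x := by
      intro x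
      induction x using QuotientGroup.induction_on with
      | H z => rfl
    refine ⟨Equiv.mulLeft b⁻¹, fun g a => ?_, fun a h => ?_⟩
    · have h := hb g
      rw [hid] at h
      change _ = b * π' (QuotientGroup.mk g) * b⁻¹ at h
      rw [h]
      simp [mul_assoc]
    · simp [mul_assoc]
end

section
/- Let G be a finite group and F ≤ G a subgroup. Then there exists a subset Q ⊆ G that is simultaneously a complete set of representatives of the left cosets of F in G and of the right cosets of F in G; that is, the map Q → G/F, q ↦ qF, is a bijection and the map Q → F\G, q ↦ Fq, is a bijection. -/
/-- For a finite group `G` and a subgroup `F ≤ G`, there exists a subset `Q ⊆ G` which is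
simultaneously a complete set of representatives of the left cosets of `F` in `G` and of
the right cosets of `F` in `G`. -/
theorem exists_simultaneous_coset_representatives
    {G : Type*} [Group G] [Finite G] (F : Subgroup G) :
    ∃ Q : Set G,
      Function.Bijective (fun q : Q => (QuotientGroup.mk q.1 : G ⧸ F)) ∧
      Function.Bijective (fun q : Q => Quotient.mk (QuotientGroup.rightRel F) q.1) := by
  classical
  have := Fintype.ofFinite G
  have := Fintype.ofFinite (G ⧸ F)
  have := Fintype.ofFinite (Quotient (QuotientGroup.rightRel F))
  let l : G → G ⧸ F := fun g => QuotientGroup.mk g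
  let r : G → Quotient (QuotientGroup.rightRel F) := fun g => Quotient.mk _ g
  let K : Finset G := Finset.univ.filter (· ∈ F)
  have hK : 0 < K.card := Finset.card_pos.2 ⟨1, by simp [K, F.one_mem]⟩
  let t : G ⧸ F → Finset (Quotient (QuotientGroup.rightRel F)) := fun x =>
    (Finset.univ.filter (fun g => l g = x)).image r
  have hall : ∀ s : Finset (G ⧸ F), s.card ≤ (s.biUnion t).card := by
    intro s
    let A : Finset G := Finset.univ.filter (fun g => l g ∈ s)
    have h1 : K.card * s.card ≤ A.card := by
      apply Finset.mul_card_image_le_card_of_maps_to (f := l)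
      · intro g hg
        simpa [A] using hg
      · intro x hx
        obtain ⟨a, rfl⟩ := QuotientGroup.mk_surjective x
        apply Finset.card_le_card_of_injOn (fun k => a * k)
        · intro k hk
          have hk' : k ∈ F := by simpa [K] using hk
          have e : l (a * k) = QuotientGroup.mk a := QuotientGroup.mk_mul_of_mem a hk'
          simp [A, e, hx]
        · intro x _ y _ h
          exact mul_left_cancel h
    have h2 : A.card ≤ K.card * (s.biUnion t).card := by
      apply Finset.card_le_mul_card_image_of_maps_to (f := r)
      · intro g hg
        have hg' : l g ∈ s := by simpa [A] using hg
        exact Finset.mem_biUnion.2 ⟨l g, hg', Finset.mem_image.2 ⟨g, by simp, rfl⟩⟩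
      · intro y _
        obtain ⟨a, rfl⟩ := Quotient.exists_rep y
        apply Finset.card_le_card_of_injOn (fun k => a * k⁻¹)
        · intro k hk
          have hk' : r k = Quotient.mk _ a := (by simpa using hk : _ ∧ _).2
          have := QuotientGroup.rightRel_apply.1 (Quotient.exact hk')
          simpa [K] using this
        · intro x _ y _ h
          exact inv_injective (mul_left_cancel h)
    exact Nat.le_of_mul_le_mul_left (h1.trans h2) hK
  obtain ⟨f, hf, hft⟩ := (Finset.all_card_le_biUnion_card_iff_exists_injective t).1 hall
  have hfb : Function.Bijective f := (Fintype.bijective_iff_injective_and_card f).2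
    ⟨hf, (Fintype.card_congr (QuotientGroup.quotientRightRelEquivQuotientLeftRel F)).symm⟩
  have hg : ∀ x, ∃ g, l g = x ∧ r g = f x := by
    intro x
    obtain ⟨g, h, h'⟩ := Finset.mem_image.1 (hft x)
    exact ⟨g, by simpa using h, h'⟩
  choose g hl hr using hg
  refine ⟨Set.range g, ⟨?_, ?_⟩, ?_, ?_⟩
  · rintro ⟨_, x, rfl⟩ ⟨_, y, rfl⟩ h
    have h' : l (g x) = l (g y) := h
    rw [hl, hl] at h'
    subst h'; rfl
  · intro x
    exact ⟨⟨g x, x, rfl⟩, hl x⟩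
  · rintro ⟨_, x, rfl⟩ ⟨_, y, rfl⟩ h
    have h' : r (g x) = r (g y) := h
    rw [hr, hr] at h'
    have := hf h'
    subst this; rfl
  · intro y
    obtain ⟨x, rfl⟩ := hfb.2 y
    exact ⟨⟨g x, x, rfl⟩, hr x⟩
end

section
/- Let G be a finite group, H ≤ G a subgroup, X = G/H the left G-set of left cosets with G acting by left translation, k a field, n ≥ 1, and f ∈ Cⁿ⁺¹(G, C¹(X,kˣ)). If the set Hⁿ_G(X,kˣ)_f is nonempty, then there is a bijection between Hⁿ_G(X,kˣ)_f and Hⁿ(H,kˣ), the n-th group cohomology of H with trivial coefficients in kˣ. -/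
/-- Normalized `n`-cochains: maps `β : Gⁿ × X → kˣ` equal to `1` whenever some argument is `1`. -/
def IsNormalizedCochain {G X k : Type*} [Group G] [Field k] (n : ℕ)
    (β : (Fin n → G) → X → kˣ) : Prop :=
  ∀ (σ : Fin n → G) (x : X), (∃ i, σ i = 1) → β σ x = 1

/-- The differential `δ_G : Cⁿ(G, C¹(X,kˣ)) → Cⁿ⁺¹(G, C¹(X,kˣ))`. -/
def deltaG {G X k : Type*} [Group G] [Field k] [MulAction G X] (n : ℕ)
    (β : (Fin n → G) → X → kˣ) : (Fin (n + 1) → G) → X → kˣ :=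
  fun σ x =>
    β (fun j => σ j.succ) x
      * (∏ j : Fin n, β (Fin.contractNth j.castSucc (· * ·) σ) x ^ ((-1 : ℤ) ^ ((j : ℕ) + 1)))
      * β (fun j => σ j.castSucc) (σ (Fin.last n) • x) ^ ((-1 : ℤ) ^ (n + 1))

/-- The set `Hⁿ_G(X,kˣ)_f = Zⁿ_G(X,kˣ)_f / Bⁿ_G(X,kˣ)` of orbits of the `f`-twisted
`(m+1)`-cocycles under multiplication by coboundaries. -/
def twistedHG (G X k : Type*) [Group G] [Field k] [MulAction G X] (m : ℕ)
    (f : (Fin (m + 2) → G) → X → kˣ) : Type _ :=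
  Quot (fun (α α' : {a : (Fin (m + 1) → G) → X → kˣ //
      IsNormalizedCochain (m + 1) a ∧ deltaG (m + 1) a = f}) =>
    ∃ β, IsNormalizedCochain m β ∧
      (α' : (Fin (m + 1) → G) → X → kˣ) = (α : (Fin (m + 1) → G) → X → kˣ) * deltaG m β)

/-- Normalized inhomogeneous `n`-cochains of a group `H` with coefficients in `kˣ`. -/
def IsNormalizedGrpCochain {H k : Type*} [Group H] [Field k] (n : ℕ)
    (β : (Fin n → H) → kˣ) : Prop :=
  ∀ σ : Fin n → H, (∃ i, σ i = 1) → β σ = 1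

/-- The inhomogeneous differential for group cohomology of `H` with trivial
coefficients in `kˣ`. -/
def deltaGrp {H k : Type*} [Group H] [Field k] (n : ℕ)
    (β : (Fin n → H) → kˣ) : (Fin (n + 1) → H) → kˣ :=
  fun σ =>
    β (fun j => σ j.succ)
      * (∏ j : Fin n, β (Fin.contractNth j.castSucc (· * ·) σ) ^ ((-1 : ℤ) ^ ((j : ℕ) + 1)))
      * β (fun j => σ j.castSucc) ^ ((-1 : ℤ) ^ (n + 1))

/-- Group cohomology `Hⁿ(H,kˣ)` (with `n = m+1`) of `H` with trivial coefficients in `kˣ`,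
computed with normalized inhomogeneous cochains. -/
def grpH (H k : Type*) [Group H] [Field k] (m : ℕ) : Type _ :=
  Quot (fun (α α' : {a : (Fin (m + 1) → H) → kˣ //
      IsNormalizedGrpCochain (m + 1) a ∧ deltaGrp (m + 1) a = 1}) =>
    ∃ β, IsNormalizedGrpCochain m β ∧
      (α' : (Fin (m + 1) → H) → kˣ) = (α : (Fin (m + 1) → H) → kˣ) * deltaGrp m β)

namespace TwSh

open Fin

section Homog
variable {G M : Type*} [AddCommGroup M]

/-- Homogeneous (augmented) differential. -/
def D (n : ℕ) (A : (Fin n → G) → M) (g : Fin (n + 1) → G) : M :=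
  ∑ i : Fin (n + 1), ((-1 : ℤ) ^ (i : ℕ)) • A (fun j => g (i.succAbove j))

theorem D_cons (n : ℕ) (A : (Fin (n + 1) → G) → M) (a : G) (t : Fin (n + 1) → G) :
    D (n + 1) A (Fin.cons a t) = A t - D n (fun s => A (Fin.cons a s)) t := by
  unfold D
  rw [Fin.sum_univ_succ, sub_eq_add_neg, ← Finset.sum_neg_distrib]
  congr 1
  · simp
  · refine Finset.sum_congr rfl fun i _ => ?_
    have : (fun j => (Fin.cons a t : Fin (n + 2) → G) (i.succ.succAbove j)) =
        Fin.cons a (fun j => t (i.succAbove j)) := by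
      funext j
      refine Fin.cases ?_ (fun j => ?_) j <;> simp
    rw [this]
    simp [pow_succ]

theorem D_sub (n : ℕ) (A B : (Fin n → G) → M) (g : Fin (n + 1) → G) :
    D n (fun s => A s - B s) g = D n A g - D n B g := by
  simp [D, smul_sub, Finset.sum_sub_distrib]

/-- The prism operator. -/
def P (r : G → G) : (n : ℕ) → ((Fin (n + 1) → G) → M) → (Fin n → G) → M
  | 0, _, _ => 0
  | n + 1, A, g => A (Fin.cons (g 0) (Fin.cons (r (g 0)) (fun j => r (g j.succ))))
      - P r n (fun t => A (Fin.cons (g 0) t)) (fun j => g j.succ)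

theorem P_cons (r : G → G) (n : ℕ) (A : (Fin (n + 2) → G) → M) (a : G) (t : Fin n → G) :
    P r (n + 1) A (Fin.cons a t) = A (Fin.cons a (Fin.cons (r a) (fun j => r (t j))))
      - P r n (fun t => A (Fin.cons a t)) t := by
  simp [P]

theorem P_sub (r : G → G) (n : ℕ) (A B : (Fin (n + 1) → G) → M) (g : Fin n → G) :
    P r n (fun s => A s - B s) g = P r n A g - P r n B g := by
  induction n with
  | zero => simp [P]
  | succ n ih => simp only [P, ih]; abel

theorem homotopy (r : G → G) (n : ℕ) (A : (Fin (n + 1) → G) → M) (g : Fin (n + 1) → G) :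
    D n (P r n A) g + P r (n + 1) (D (n + 1) A) g = A (fun j => r (g j)) - A g := by
  induction n with
  | zero =>
    have h1 : (fun j => r (g j)) = (Fin.cons (r (g 0)) (fun j : Fin 0 => r (g j.succ)) : Fin 1 → G) := by
      funext j; fin_cases j; rfl
    have h2 : (fun s : Fin 0 → G => A (Fin.cons (g 0) s)) = fun _ => A g := by
      funext s; congr 1; funext j; fin_cases j; rfl
    simp [P, D_cons, h1, h2]
    simp [D]
  | succ n ih =>
    induction g using Fin.consCases with
    | _ a t =>
    have hr : (fun j => r ((Fin.cons a t : Fin (n + 2) → G) j)) =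
        Fin.cons (r a) (fun j => r (t j)) := by
      funext j; refine Fin.cases ?_ (fun j => ?_) j <;> simp
    have hi := ih (fun s => A (Fin.cons a s)) t
    have e1 : (fun s => P r (n + 1) A (Fin.cons a s)) = fun s =>
      A (Fin.cons a (Fin.cons (r a) (fun j => r (s j)))) - P r n (fun t => A (Fin.cons a t)) s := by
      funext s; rw [P_cons]
    have e2 : (fun s => D (n + 2) A (Fin.cons a s)) = fun s =>
      A s - D (n + 1) (fun s => A (Fin.cons a s)) s := by
      funext s; rw [D_cons]
    rw [D_cons, P_cons, e1, e2, D_sub, P_sub, D_cons, D_cons, hr]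
    have e3 : D n (fun s => A (Fin.cons a (Fin.cons (r a) s))) (fun j => r (t j)) =
      D n (fun s => A (Fin.cons a (Fin.cons (r a) (fun j => r (s j))))) t := rfl
    rw [e3]
    rw [← sub_eq_zero] at hi ⊢
    rw [← hi]
    abel

theorem P_trans (r : G → G) (u : G → G) (hu : ∀ g, r (u g) = u (r g)) (n : ℕ)
    (A : (Fin (n + 1) → G) → M) (g : Fin n → G) :
    P r n A (fun j => u (g j)) = P r n (fun t => A (fun j => u (t j))) g := by
  induction n with
  | zero => rfl
  | succ n ih =>
    simp only [P]
    rw [ih]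
    congr 1
    · congr 1
      funext j
      refine Fin.cases ?_ (fun j => ?_) j
      · simp
      · refine Fin.cases ?_ (fun j => ?_) j <;> simp [hu]
    · congr 1
      funext t
      congr 1
      funext j
      refine Fin.cases ?_ (fun j => ?_) j <;> simp

/-- Normalized homogeneous cochains. -/
def Nrm (n : ℕ) (A : (Fin (n + 1) → G) → M) : Prop :=
  ∀ g : Fin (n + 1) → G, (∃ i : Fin n, g i.castSucc = g i.succ) → A g = 0

theorem P_zero (r : G → G) (n : ℕ) (A : (Fin (n + 1) → G) → M) (g : Fin n → G)
    (h : ∀ (hn : 0 < n) (t : Fin n → G), A (Fin.cons (g ⟨0, hn⟩) t) = 0) : P r n A g = 0 := by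
  cases n with
  | zero => rfl
  | succ n =>
    have h' := h (Nat.succ_pos n)
    have e : (⟨0, Nat.succ_pos n⟩ : Fin (n + 1)) = 0 := rfl
    rw [e] at h'
    simp only [P, h']
    have : ∀ (n : ℕ) (g : Fin n → G), P r n (fun _ => (0 : M)) g = 0 := by
      intro n
      induction n with
      | zero => intro g; rfl
      | succ n ih => intro g; simp [P, ih]
    simp [this]

theorem P_nrm (r : G → G) (n : ℕ) (A : (Fin (n + 2) → G) → M) (hA : Nrm (n + 1) A) :
    Nrm n (P r (n + 1) A) := by
  induction n with
  | zero => rintro g ⟨i, _⟩; exact i.elim0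
  | succ n ih =>
    rintro g ⟨i, hi⟩
    have key : ∀ b : G, Nrm (n + 1) (fun t => A (Fin.cons b t)) := by
      rintro b g ⟨i, hi⟩
      refine hA _ ⟨i.succ, ?_⟩
      rw [← Fin.succ_castSucc]
      simpa using hi
    rw [P]
    have h1 : A (Fin.cons (g 0) (Fin.cons (r (g 0)) (fun j => r (g j.succ)))) = 0 := by
      refine hA _ ⟨i.succ, ?_⟩
      rw [← Fin.succ_castSucc, Fin.cons_succ, Fin.cons_succ, Fin.cons_succ, ← hi]
      refine Fin.cases ?_ (fun j => ?_) i
      · simp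
      · rw [← Fin.succ_castSucc]; simp
    rw [h1, zero_sub, neg_eq_zero]
    revert hi
    refine Fin.cases ?_ (fun j => ?_) i
    · intro hi
      apply P_zero
      intro hn t
      refine hA _ ⟨0, ?_⟩
      simpa using hi
    · intro hi
      exact ih _ (key _) _ ⟨j, by rw [Fin.succ_castSucc]; exact hi⟩

end Homog

section Translate
variable {G X k : Type*} [Group G] [Field k] [MulAction G X]

/-- Homogenization. -/
def Phi (x₀ : X) (n : ℕ) (β : (Fin n → G) → X → kˣ) (g : Fin (n + 1) → G) : Additive kˣ :=
  Additive.ofMul (β (fun i => g i.castSucc * (g i.succ)⁻¹) (g (Fin.last n) • x₀))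

theorem contract_eq (n : ℕ) (g : Fin (n + 2) → G) (j : Fin n) :
    Fin.contractNth j.castSucc (· * ·) (fun i : Fin (n + 1) => g i.castSucc * (g i.succ)⁻¹) =
    fun i : Fin n => g (j.castSucc.succ.succAbove i.castSucc) *
      (g (j.castSucc.succ.succAbove i.succ))⁻¹ := by
  funext i
  rcases lt_trichotomy (i : ℕ) j with h | h | h
  · rw [Fin.contractNth_apply_of_lt _ _ _ _ (by simpa using h)]
    rw [Fin.succAbove_of_castSucc_lt, Fin.succAbove_of_castSucc_lt] <;>
      first | (simp only [Fin.lt_def, Fin.val_castSucc, Fin.val_succ]; omega) | simp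
  · rw [Fin.contractNth_apply_of_eq _ _ _ _ (by simpa using h)]
    rw [Fin.succAbove_of_castSucc_lt, Fin.succAbove_of_le_castSucc]
    · simp
    · simp only [Fin.le_def, Fin.val_castSucc, Fin.val_succ]; omega
    · simp only [Fin.lt_def, Fin.val_castSucc, Fin.val_succ]; omega
  · rw [Fin.contractNth_apply_of_gt _ _ _ _ (by simpa using h)]
    rw [Fin.succAbove_of_le_castSucc, Fin.succAbove_of_le_castSucc] <;>
      first | (simp only [Fin.le_def, Fin.val_castSucc, Fin.val_succ]; omega) | simp

theorem Phi_delta (x₀ : X) (n : ℕ) (β : (Fin n → G) → X → kˣ) (g : Fin (n + 2) → G) :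
    Phi x₀ (n + 1) (deltaG n β) g = D (n + 1) (Phi x₀ n β) g := by
  unfold D Phi deltaG
  rw [Fin.sum_univ_succ, Fin.sum_univ_castSucc, ofMul_mul, ofMul_mul, ofMul_prod, add_assoc]
  congr 1
  · simp
  congr 1
  · refine Finset.sum_congr rfl fun j _ => ?_
    rw [ofMul_zpow, contract_eq]
    congr 4
    simp
  · rw [ofMul_zpow, Fin.succ_last, Fin.val_last]
    congr 3
    · funext i
      simp
    · simp [mul_smul]

theorem Phi_nrm (x₀ : X) (n : ℕ) (β : (Fin n → G) → X → kˣ) (hβ : IsNormalizedCochain n β) :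
    Nrm n (Phi x₀ n β) := by
  rintro g ⟨i, hi⟩
  unfold Phi
  rw [hβ _ _ ⟨i, by rw [hi, mul_inv_cancel]⟩]
  rfl

/-- The path of group elements. -/
def path (n : ℕ) (σ : Fin n → G) (g : G) (i : Fin (n + 1)) : G :=
  (Fin.partialProd σ i)⁻¹ * Fin.partialProd σ (Fin.last n) * g

theorem path_last (n : ℕ) (σ : Fin n → G) (g : G) : path n σ g (Fin.last n) = g := by
  simp [path]

theorem path_castSucc (n : ℕ) (σ : Fin n → G) (g : G) (i : Fin n) :
    path n σ g i.castSucc = σ i * path n σ g i.succ := by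
  simp [path, Fin.partialProd_succ, mul_assoc]

theorem path_quot (n : ℕ) (g : Fin (n + 1) → G) (u : G) (i : Fin (n + 1)) :
    path n (fun i => g i.castSucc * (g i.succ)⁻¹) u i = g i * ((g (Fin.last n))⁻¹ * u) := by
  induction i using Fin.reverseInduction with
  | last => simp [path_last]
  | cast i ih => rw [path_castSucc, ih]; group

end Translate

section Sub
variable {G k : Type*} [Group G] (H : Subgroup G) [Field k]

/-- Dehomogenization. -/
noncomputable def Psi (n : ℕ) (A : (Fin (n + 1) → G) → Additive kˣ) (σ : Fin n → G) (x : G ⧸ H) :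
    kˣ := Additive.toMul (A (path n σ x.out))

/-- The base point. -/
def bp : G ⧸ H := QuotientGroup.mk 1

theorem smul_bp (g : G) : g • bp H = QuotientGroup.mk g := by
  simp [bp, MulAction.Quotient.smul_mk]

theorem Phi_Psi (n : ℕ) (A : (Fin (n + 1) → G) → Additive kˣ)
    (hA : ∀ (h : H) g, A (fun j => g j * h) = A g) (g : Fin (n + 1) → G) :
    Phi (bp H) n (Psi H n A) g = A g := by
  unfold Phi Psi
  rw [ofMul_toMul, smul_bp]
  have hm : (g (Fin.last n))⁻¹ * (QuotientGroup.mk (g (Fin.last n)) : G ⧸ H).out ∈ H := by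
    rw [← QuotientGroup.eq]; simp
  rw [← hA ⟨_, hm⟩ g]
  congr 1
  funext i
  rw [path_quot]

theorem Phi_inj (n : ℕ) (β β' : (Fin n → G) → (G ⧸ H) → kˣ)
    (h : ∀ g, Phi (bp H) n β g = Phi (bp H) n β' g) : β = β' := by
  funext σ x
  have := h (path n σ x.out)
  unfold Phi at this
  simpa [path_last, path_castSucc, smul_bp] using this

theorem Psi_nrm (n : ℕ) (A : (Fin (n + 1) → G) → Additive kˣ) (hA : Nrm n A) :
    IsNormalizedCochain n (Psi H n A) := by
  rintro σ x ⟨i, hi⟩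
  unfold Psi
  rw [hA _ ⟨i, by rw [path_castSucc, hi, one_mul]⟩]
  rfl

theorem Phi_inv (n : ℕ) (β : (Fin n → G) → (G ⧸ H) → kˣ) (h : H) (g : Fin (n + 1) → G) :
    Phi (bp H) n β (fun j => g j * h) = Phi (bp H) n β g := by
  unfold Phi
  congr 2
  · funext i; group
  · rw [smul_bp, smul_bp]; simp

/-- Restriction to the subgroup. -/
def res (n : ℕ) (β : (Fin n → G) → (G ⧸ H) → kˣ) (τ : Fin n → H) : kˣ :=
  β (fun i => (τ i : G)) (bp H)

/-- Homogenization for the subgroup. -/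
def PhiH (n : ℕ) (γ : (Fin n → H) → kˣ) (g : Fin (n + 1) → H) : Additive kˣ :=
  Phi PUnit.unit n (fun σ (_ : PUnit.{1}) => γ σ) g

theorem PhiH_delta (n : ℕ) (γ : (Fin n → H) → kˣ) (g : Fin (n + 2) → H) :
    PhiH H (n + 1) (deltaGrp n γ) g = D (n + 1) (PhiH H n γ) g :=
  Phi_delta PUnit.unit n (fun σ (_ : PUnit.{1}) => γ σ) g

theorem PhiH_nrm (n : ℕ) (γ : (Fin n → H) → kˣ) (hγ : IsNormalizedGrpCochain n γ) :
    Nrm n (PhiH H n γ) :=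
  Phi_nrm PUnit.unit n (fun σ (_ : PUnit.{1}) => γ σ) (fun σ _ h => hγ σ h)

theorem PhiH_inj (n : ℕ) (γ γ' : (Fin n → H) → kˣ)
    (h : ∀ g, PhiH H n γ g = PhiH H n γ' g) : γ = γ' := by
  funext σ
  have := h (path n σ 1)
  unfold PhiH Phi at this
  simpa [path_castSucc] using this

theorem res_nrm (n : ℕ) (β : (Fin n → G) → (G ⧸ H) → kˣ) (hβ : IsNormalizedCochain n β) :
    IsNormalizedGrpCochain n (res H n β) := by
  rintro σ ⟨i, hi⟩
  exact hβ _ _ ⟨i, by simp [hi]⟩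

theorem PhiH_res (n : ℕ) (β : (Fin n → G) → (G ⧸ H) → kˣ) (g : Fin (n + 1) → H) :
    PhiH H n (res H n β) g = Phi (bp H) n β (fun j => (g j : G)) := by
  unfold PhiH Phi res
  congr 2
  rw [smul_bp, bp]
  have h : (1 : G)⁻¹ * (g (Fin.last n) : G) ∈ H := by simp
  exact congrArg (β _) (QuotientGroup.eq.2 h)

theorem res_delta (n : ℕ) (β : (Fin n → G) → (G ⧸ H) → kˣ) :
    res H (n + 1) (deltaG n β) = deltaGrp n (res H n β) := by
  apply PhiH_inj
  intro g
  rw [PhiH_res, Phi_delta, PhiH_delta]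
  unfold D
  simp only [PhiH_res]

/-- The retraction onto `H`. -/
noncomputable def ret (g : G) : H :=
  ⟨(bp H).out * ((QuotientGroup.mk g : G ⧸ H).out⁻¹ * g), by
    apply H.mul_mem
    · have : (1 : G)⁻¹ * (bp H).out ∈ H := by
        rw [← QuotientGroup.eq]; simp [bp]
      simpa using this
    · rw [← QuotientGroup.eq]; simp⟩

theorem ret_mul (g : G) (h : H) : ret H (g * h) = ret H g * h := by
  ext
  simp [ret, mul_assoc]

theorem ret_coe (h : H) : ret H (h : G) = h := by
  have : (QuotientGroup.mk (h : G) : G ⧸ H) = bp H := QuotientGroup.eq.2 (by simp)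
  ext
  simp [ret, this]

/-- Corestriction-like map. -/
noncomputable def cor (n : ℕ) (γ : (Fin n → H) → kˣ) : (Fin n → G) → (G ⧸ H) → kˣ :=
  Psi H n (fun g => PhiH H n γ (fun j => ret H (g j)))

theorem Phi_cor (n : ℕ) (γ : (Fin n → H) → kˣ) (g : Fin (n + 1) → G) :
    Phi (bp H) n (cor H n γ) g = PhiH H n γ (fun j => ret H (g j)) := by
  unfold cor
  rw [Phi_Psi]
  intro h g
  simp only [ret_mul]
  unfold PhiH Phi
  refine congrArg (fun s => Additive.ofMul (γ s)) ?_
  funext i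
  group

theorem cor_delta (n : ℕ) (γ : (Fin n → H) → kˣ) :
    deltaG n (cor H n γ) = cor H (n + 1) (deltaGrp n γ) := by
  apply Phi_inj
  intro g
  rw [Phi_cor, Phi_delta, PhiH_delta]
  unfold D
  simp only [Phi_cor]

theorem res_cor (n : ℕ) (γ : (Fin n → H) → kˣ) : res H n (cor H n γ) = γ := by
  apply PhiH_inj
  intro g
  rw [PhiH_res, Phi_cor]
  simp only [ret_coe]

theorem cor_nrm (n : ℕ) (γ : (Fin n → H) → kˣ) (hγ : IsNormalizedGrpCochain n γ) :
    IsNormalizedCochain n (cor H n γ) := by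
  apply Psi_nrm
  rintro g ⟨i, hi⟩
  exact PhiH_nrm H n γ hγ _ ⟨i, by rw [hi]⟩

theorem cor_one (n : ℕ) : cor H n (1 : (Fin n → H) → kˣ) = 1 := rfl

theorem Phi_mul (n : ℕ) (β β' : (Fin n → G) → (G ⧸ H) → kˣ) (g : Fin (n + 1) → G) :
    Phi (bp H) n (β * β') g = Phi (bp H) n β g + Phi (bp H) n β' g := rfl

theorem delta_mul (n : ℕ) (β β' : (Fin n → G) → (G ⧸ H) → kˣ) :
    deltaG n (β * β') = deltaG n β * deltaG n β' := by
  funext σ x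
  simp only [deltaG, Pi.mul_apply, mul_zpow, Finset.prod_mul_distrib]
  simp only [mul_assoc, mul_left_comm]

theorem deltaGrp_mul (n : ℕ) (β β' : (Fin n → H) → kˣ) :
    deltaGrp n (β * β') = deltaGrp n β * deltaGrp n β' := by
  funext σ
  simp only [deltaGrp, Pi.mul_apply, mul_zpow, Finset.prod_mul_distrib]
  simp only [mul_assoc, mul_left_comm]

theorem delta_one (n : ℕ) : deltaG n (1 : (Fin n → G) → (G ⧸ H) → kˣ) = 1 := by
  have := delta_mul H n (1 : (Fin n → G) → (G ⧸ H) → kˣ) 1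
  simpa using this

theorem deltaGrp_one (n : ℕ) : deltaGrp n (1 : (Fin n → H) → kˣ) = 1 := by
  have := deltaGrp_mul H n (1 : (Fin n → H) → kˣ) 1
  simpa using this

theorem delta_inv (n : ℕ) (β : (Fin n → G) → (G ⧸ H) → kˣ) :
    deltaG n β⁻¹ = (deltaG n β)⁻¹ := by
  rw [eq_inv_iff_mul_eq_one, ← delta_mul, inv_mul_cancel, delta_one]

theorem deltaGrp_inv (n : ℕ) (β : (Fin n → H) → kˣ) :
    deltaGrp n β⁻¹ = (deltaGrp n β)⁻¹ := by
  rw [eq_inv_iff_mul_eq_one, ← deltaGrp_mul, inv_mul_cancel, deltaGrp_one]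

theorem nrm_mul {n : ℕ} {β β' : (Fin n → G) → (G ⧸ H) → kˣ} (h : IsNormalizedCochain n β)
    (h' : IsNormalizedCochain n β') : IsNormalizedCochain n (β * β') := by
  intro σ x hs
  simp [h σ x hs, h' σ x hs]

theorem nrm_inv {n : ℕ} {β : (Fin n → G) → (G ⧸ H) → kˣ} (h : IsNormalizedCochain n β) :
    IsNormalizedCochain n β⁻¹ := by
  intro σ x hs
  simp [h σ x hs]

theorem nrmH_mul {n : ℕ} {β β' : (Fin n → H) → kˣ} (h : IsNormalizedGrpCochain n β)
    (h' : IsNormalizedGrpCochain n β') : IsNormalizedGrpCochain n (β * β') := by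
  intro σ hs
  simp [h σ hs, h' σ hs]

theorem nrmH_inv {n : ℕ} {β : (Fin n → H) → kˣ} (h : IsNormalizedGrpCochain n β) :
    IsNormalizedGrpCochain n β⁻¹ := by
  intro σ hs
  simp [h σ hs]

/-- A cocycle is cohomologous to the image of its restriction. -/
theorem cor_res (m : ℕ) (a : (Fin (m + 1) → G) → (G ⧸ H) → kˣ)
    (ha : IsNormalizedCochain (m + 1) a) (hd : deltaG (m + 1) a = 1) :
    ∃ β, IsNormalizedCochain m β ∧ cor H (m + 1) (res H (m + 1) a) = a * deltaG m β := by
  let r : G → G := fun g => (ret H g : G)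
  refine ⟨Psi H m (P r (m + 1) (Phi (bp H) (m + 1) a)), ?_, ?_⟩
  · exact Psi_nrm H m _ (P_nrm r m _ (Phi_nrm _ _ _ ha))
  · apply Phi_inj
    intro g
    have hP : ∀ g, Phi (bp H) m (Psi H m (P r (m + 1) (Phi (bp H) (m + 1) a))) g =
        P r (m + 1) (Phi (bp H) (m + 1) a) g := by
      intro g
      apply Phi_Psi
      intro h g
      rw [P_trans r (fun x => x * (h : G)) (fun x => by simp [r, ret_mul])]
      congr 1
      funext t
      exact Phi_inv H _ a h t
    have hh := homotopy r (m + 1) (Phi (bp H) (m + 1) a) g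
    have hz : D (m + 2) (Phi (bp H) (m + 1) a) = fun _ => 0 := by
      funext g
      rw [← Phi_delta, hd]
      rfl
    rw [hz, P_zero r (m + 2) _ _ (fun _ _ => rfl), add_zero] at hh
    rw [Phi_mul, Phi_delta, funext hP, hh, Phi_cor, PhiH_res]
    abel

end Sub

end TwSh

/-- Shapiro's Lemma, twisted version: for a finite group `G`, a subgroup `H ≤ G`,
`X = G/H` with the left translation action, and a normalized twist `f ∈ Cⁿ⁺¹`
(`n = m+1 ≥ 1`), if `Hⁿ_G(X,kˣ)_f` is nonempty then it is in bijection with `Hⁿ(H,kˣ)`. -/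
theorem twisted_shapiro
    {G : Type*} [Group G] [Finite G] (H : Subgroup G) {k : Type*} [Field k]
    (m : ℕ) (f : (Fin (m + 2) → G) → (G ⧸ H) → kˣ)
    (hf : IsNormalizedCochain (m + 2) f)
    (hne : ∃ α, IsNormalizedCochain (m + 1) α ∧ deltaG (m + 1) α = f) :
    Nonempty (twistedHG G (G ⧸ H) k m f ≃ grpH (↥H) k m) := by
  obtain ⟨α₀, hα₀, hδ₀⟩ := hne
  have eqv : Equivalence (fun (α α' : {a : (Fin (m + 1) → H) → kˣ //
      IsNormalizedGrpCochain (m + 1) a ∧ deltaGrp (m + 1) a = 1}) =>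
    ∃ β, IsNormalizedGrpCochain m β ∧
      (α' : (Fin (m + 1) → H) → kˣ) = (α : (Fin (m + 1) → H) → kˣ) * deltaGrp m β) := by
    refine ⟨fun a => ⟨1, fun _ _ => rfl, by simp [TwSh.deltaGrp_one]⟩, ?_, ?_⟩
    · rintro a b ⟨β, hβ, h⟩
      exact ⟨β⁻¹, TwSh.nrmH_inv H hβ, by rw [h, TwSh.deltaGrp_inv, mul_inv_cancel_right]⟩
    · rintro a b c ⟨β, hβ, h⟩ ⟨β', hβ', h'⟩
      exact ⟨β * β', TwSh.nrmH_mul H hβ hβ', by rw [h', h, TwSh.deltaGrp_mul, mul_assoc]⟩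
  have hcyc : ∀ a : {a : (Fin (m + 1) → G) → (G ⧸ H) → kˣ //
      IsNormalizedCochain (m + 1) a ∧ deltaG (m + 1) a = f},
      IsNormalizedCochain (m + 1) (a.1 * α₀⁻¹) ∧ deltaG (m + 1) (a.1 * α₀⁻¹) = 1 := by
    intro a
    refine ⟨TwSh.nrm_mul H a.2.1 (TwSh.nrm_inv H hα₀), ?_⟩
    rw [TwSh.delta_mul, TwSh.delta_inv, a.2.2, hδ₀, mul_inv_cancel]
  let F : twistedHG G (G ⧸ H) k m f → grpH (↥H) k m :=
    Quot.map (fun a => ⟨TwSh.res H (m + 1) (a.1 * α₀⁻¹),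
      TwSh.res_nrm H _ _ (hcyc a).1, (TwSh.res_delta H (m + 1) _).symm.trans (by rw [(hcyc a).2]; rfl)⟩) (by
      rintro a b ⟨β, hβ, h⟩
      refine ⟨TwSh.res H m β, TwSh.res_nrm H _ _ hβ, ?_⟩
      change TwSh.res H (m + 1) (b.1 * α₀⁻¹) =
        TwSh.res H (m + 1) (a.1 * α₀⁻¹) * deltaGrp m (TwSh.res H m β)
      rw [← TwSh.res_delta, h, mul_right_comm]
      rfl)
  refine ⟨Equiv.ofBijective F ⟨?_, ?_⟩⟩
  · rintro ⟨a⟩ ⟨b⟩ hab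
    obtain ⟨γ, hγ, h⟩ := (eqv.quot_mk_eq_iff _ _).1 hab
    obtain ⟨β₁, hβ₁, h₁⟩ := TwSh.cor_res H m _ (hcyc a).1 (hcyc a).2
    obtain ⟨β₂, hβ₂, h₂⟩ := TwSh.cor_res H m _ (hcyc b).1 (hcyc b).2
    apply Quot.sound
    refine ⟨β₁ * TwSh.cor H m γ * β₂⁻¹, TwSh.nrm_mul H (TwSh.nrm_mul H hβ₁ (TwSh.cor_nrm H m γ hγ))
      (TwSh.nrm_inv H hβ₂), ?_⟩
    have hc := congrArg (TwSh.cor H (m + 1)) h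
    have hm : ∀ x y : (Fin (m + 1) → H) → kˣ,
      TwSh.cor H (m + 1) (x * y) = TwSh.cor H (m + 1) x * TwSh.cor H (m + 1) y := fun _ _ => rfl
    simp only [hm] at hc
    rw [h₁, h₂, ← TwSh.cor_delta] at hc
    rw [TwSh.delta_mul, TwSh.delta_mul, TwSh.delta_inv, ← mul_assoc, ← mul_assoc,
      eq_mul_inv_iff_mul_eq, ← mul_left_inj α₀⁻¹]
    rw [mul_right_comm, hc]
    simp only [mul_assoc, mul_left_comm, mul_comm]
  · rintro ⟨c⟩
    refine ⟨Quot.mk _ ⟨TwSh.cor H (m + 1) c.1 * α₀,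
      TwSh.nrm_mul H (TwSh.cor_nrm H _ _ c.2.1) hα₀, ?_⟩, ?_⟩
    · rw [TwSh.delta_mul, TwSh.cor_delta, c.2.2, hδ₀, TwSh.cor_one, one_mul]
    · refine congrArg (Quot.mk _) (Subtype.ext ?_)
      simp only [mul_inv_cancel_right]
      exact TwSh.res_cor H (m + 1) c.1
end
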